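/- Sturm's theorem: let R, S ∈ ℝ[X] be nonzero polynomials and let (S_0, S_1, …, S_n) be the euclidean Sturm chain associated to the fraction R/S. Then for all a < b in ℝ, Ind_a^b(R/S) = V_a^b(S_0, S_1, …, S_n). -/

import Mathlib

open Polynomial

/-- The value at `x` of the "unit part" of `P` after removing the factor `(X - x)^m`,
where `m` is the multiplicity of `x` as a root of `P`. Nonzero whenever `P ≠ 0`. -/
noncomputable def unitEval (P : Polynomial ℝ) (x : ℝ) : ℝ :=
  (P /ₘ (X - C x) ^ rootMultiplicity x P).eval x

/-- One-sided Cauchy index `Ind_x^+` of the rational function `R/S` at `x`. -/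
noncomputable def indPlus (R S : Polynomial ℝ) (x : ℝ) : ℝ :=
  if (rootMultiplicity x R : ℤ) < (rootMultiplicity x S : ℤ) then
    (1 / 2) * Real.sign (unitEval R x * unitEval S x)
  else 0

/-- One-sided Cauchy index `Ind_x^-` of the rational function `R/S` at `x`. -/
noncomputable def indMinus (R S : Polynomial ℝ) (x : ℝ) : ℝ :=
  if (rootMultiplicity x R : ℤ) < (rootMultiplicity x S : ℤ) then
    (1 / 2) * (-1 : ℝ) ^ (rootMultiplicity x S - rootMultiplicity x R) *
      Real.sign (unitEval R x * unitEval S x)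
  else 0

/-- Local Cauchy index `Ind_x(R/S) = Ind_x^+(R/S) - Ind_x^-(R/S)`. -/
noncomputable def indPoint (R S : Polynomial ℝ) (x : ℝ) : ℝ :=
  indPlus R S x - indMinus R S x

/-- The Cauchy index `Ind_a^b(R/S)` of the rational function `R/S` on `[a, b]`:
`Ind_a^+(R/S) + Σ_{x ∈ (a,b)} Ind_x(R/S) - Ind_b^-(R/S)`, with the convention that
it is `0` when `R = 0` or `S = 0`.  (Only poles, i.e. roots of `S`, contribute to
the middle sum.) -/
noncomputable def cauchyIndex (R S : Polynomial ℝ) (a b : ℝ) : ℝ :=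
  if R = 0 ∨ S = 0 then 0
  else indPlus R S a +
      (∑ x ∈ S.roots.toFinset, if a < x ∧ x < b then indPoint R S x else 0) -
      indMinus R S b

/-- Number of sign changes `V(s_0, …, s_n) = Σ ½|sign s_{k-1} - sign s_k|` of a list of reals. -/
noncomputable def signVar : List ℝ → ℝ
  | [] => 0
  | [_] => 0
  | a :: b :: l => (1 / 2) * |Real.sign a - Real.sign b| + signVar (b :: l)

/-- Sign changes `V_x(S_0, …, S_n)` of a list of real polynomials evaluated at `x`. -/
noncomputable def signVarAt (L : List (Polynomial ℝ)) (x : ℝ) : ℝ :=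
  signVar (L.map fun P => P.eval x)

/-- The euclidean remainder sequence of `R/S`: `P 0 = S`, `P 1 = R`, and
`P (k+2) = Q · P (k+1) - P k` is the negated remainder of euclidean division of
`P k` by `P (k+1)`, so that `deg P (k+2) < deg P (k+1)`. -/
noncomputable def euclidSeq (R S : Polynomial ℝ) : ℕ → Polynomial ℝ
  | 0 => S
  | 1 => R
  | (k + 2) => -(euclidSeq R S k % euclidSeq R S (k + 1))

theorem Real.sign_mul_eq (x y : ℝ) : Real.sign (x * y) = Real.sign x * Real.sign y := by
  rcases lt_trichotomy x 0 with hx | rfl | hx <;> rcases lt_trichotomy y 0 with hy | rfl | hy <;>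
    simp [Real.sign_of_neg, Real.sign_of_pos, mul_pos_of_neg_of_neg, mul_neg_of_neg_of_pos,
      mul_neg_of_pos_of_neg, *]

theorem Real.sign_mul_self_eq_one {x : ℝ} (hx : x ≠ 0) : Real.sign x * Real.sign x = 1 := by
  rcases Real.sign_apply_eq_of_ne_zero x hx with h | h <;> simp [h]

theorem unitEval_ne_zero {P : ℝ[X]} (hP : P ≠ 0) (x : ℝ) : unitEval P x ≠ 0 :=
  eval_divByMonic_pow_rootMultiplicity_ne_zero x hP

theorem unitEval_of_eval_ne_zero {P : ℝ[X]} {x : ℝ} (h : P.eval x ≠ 0) :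
    unitEval P x = P.eval x := by
  simp [unitEval, rootMultiplicity_eq_zero (p := P) h]

theorem unitEval_mul {P Q : ℝ[X]} (hP : P ≠ 0) (hQ : Q ≠ 0) (x : ℝ) :
    unitEval (P * Q) x = unitEval P x * unitEval Q x := by
  have h : P * Q = (X - C x) ^ rootMultiplicity x (P * Q) *
      ((P /ₘ (X - C x) ^ rootMultiplicity x P) * (Q /ₘ (X - C x) ^ rootMultiplicity x Q)) := by
    rw [rootMultiplicity_mul (mul_ne_zero hP hQ), pow_add, mul_mul_mul_comm,
      pow_mul_divByMonic_rootMultiplicity_eq, pow_mul_divByMonic_rootMultiplicity_eq]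
  unfold unitEval
  rw [← eval_mul]
  generalize rootMultiplicity x (P * Q) = m at h ⊢
  rw [h, mul_divByMonic_cancel_left _ ((monic_X_sub_C x).pow m)]

/-- The sign of `F` immediately to the right of `x`. -/
noncomputable def signRight (F : ℝ[X]) (x : ℝ) : ℝ := Real.sign (unitEval F x)

/-- The sign of `F` immediately to the left of `x`. -/
noncomputable def signLeft (F : ℝ[X]) (x : ℝ) : ℝ :=
  (-1) ^ rootMultiplicity x F * Real.sign (unitEval F x)

theorem sign_eval_eq_of_no_root {F : ℝ[X]} {a b : ℝ} (hab : a ≤ b)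
    (h : ∀ x ∈ Set.Icc a b, F.eval x ≠ 0) : Real.sign (F.eval a) = Real.sign (F.eval b) := by
  have hc : ContinuousOn (fun x => F.eval x) (Set.Icc a b) := F.continuous.continuousOn
  have ha := h a (Set.left_mem_Icc.2 hab)
  have hb := h b (Set.right_mem_Icc.2 hab)
  rcases ha.lt_or_gt with ha | ha <;> rcases hb.lt_or_gt with hb | hb
  · rw [Real.sign_of_neg ha, Real.sign_of_neg hb]
  · obtain ⟨x, hx, h0⟩ := intermediate_value_Icc hab hc ⟨ha.le, hb.le⟩
    exact absurd h0 (h x hx)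
  · obtain ⟨x, hx, h0⟩ := intermediate_value_Icc' hab hc ⟨hb.le, ha.le⟩
    exact absurd h0 (h x hx)
  · rw [Real.sign_of_pos ha, Real.sign_of_pos hb]

theorem unitEval_X_sub_C_pow_self (x : ℝ) (n : ℕ) : unitEval ((X - C x) ^ n) x = 1 := by
  have h := mul_divByMonic_cancel_left (1 : ℝ[X]) ((monic_X_sub_C x).pow n)
  rw [mul_one] at h
  rw [unitEval, rootMultiplicity_X_sub_C_pow, h, eval_one]

theorem signRight_eq_signLeft {F : ℝ[X]} (hF : F ≠ 0) {a b : ℝ} (hab : a < b)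
    (h : ∀ x, a < x → x < b → F.eval x ≠ 0) : signRight F a = signLeft F b := by
  obtain ⟨G, hG, hGa⟩ := exists_eq_pow_rootMultiplicity_mul_and_not_dvd F hF a
  set i := rootMultiplicity a F
  have hG0 : G ≠ 0 := by rintro rfl; simp at hGa
  obtain ⟨H, hH, hHb⟩ := exists_eq_pow_rootMultiplicity_mul_and_not_dvd G hG0 b
  set j := rootMultiplicity b G
  have hH0 : H ≠ 0 := by rintro rfl; simp at hHb
  rw [dvd_iff_isRoot, IsRoot.def] at hGa hHb
  have hXa : ((X - C a) ^ i : ℝ[X]) ≠ 0 := pow_ne_zero _ (X_sub_C_ne_zero a)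
  have hXb : ((X - C b) ^ j : ℝ[X]) ≠ 0 := pow_ne_zero _ (X_sub_C_ne_zero b)
  have hab' : 0 < b - a := sub_pos.2 hab
  have hiter : rootMultiplicity b F = j := by
    rw [hG, rootMultiplicity_mul (mul_ne_zero hXa hG0), rootMultiplicity_eq_zero, zero_add]
    simpa using fun h => absurd h hab'.ne'
  have hHne : ∀ x ∈ Set.Icc a b, H.eval x ≠ 0 := by
    intro x hx h0
    rcases hx.1.eq_or_lt with rfl | hxa
    · exact hGa (by rw [hH, eval_mul, h0, mul_zero])
    rcases hx.2.eq_or_lt with rfl | hxb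
    · exact hHb h0
    · exact h x hxa hxb (by rw [hG, hH, eval_mul, eval_mul, h0, mul_zero, mul_zero])
  have hpos : 0 < (b - a) ^ i := pow_pos hab' _
  have hua : unitEval F a = (a - b) ^ j * H.eval a := by
    rw [hG, unitEval_mul hXa hG0, unitEval_X_sub_C_pow_self, one_mul,
      unitEval_of_eval_ne_zero hGa, hH]
    simp
  have hub : unitEval F b = (b - a) ^ i * H.eval b := by
    rw [hG, unitEval_mul hXa hG0, unitEval_of_eval_ne_zero (by simpa using hpos.ne'), hH,
      unitEval_mul hXb hH0, unitEval_X_sub_C_pow_self, one_mul, unitEval_of_eval_ne_zero hHb]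
    simp
  have hneg : Real.sign ((a - b) ^ j) = (-1) ^ j := by
    have : a - b = -1 * (b - a) := by ring
    rw [this, mul_pow, Real.sign_mul_eq, Real.sign_of_pos (pow_pos hab' j), mul_one]
    rcases neg_one_pow_eq_or ℝ j with h | h <;> simp [h, Real.sign_neg, Real.sign_one]
  rw [signRight, signLeft, hiter, hua, hub, Real.sign_mul_eq, Real.sign_mul_eq, hneg,
    Real.sign_of_pos hpos, one_mul, sign_eval_eq_of_no_root hab.le hHne]

theorem signRight_add_sum_jump {F : ℝ[X]} (hF : F ≠ 0) (T : Finset ℝ) :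
    ∀ a b : ℝ, a < b → (∀ x, a < x → x < b → F.eval x = 0 → x ∈ T) →
      signRight F a + (∑ x ∈ T, if a < x ∧ x < b then signRight F x - signLeft F x else 0) =
        signLeft F b := by
  induction T using Finset.induction_on_max with
  | empty =>
    intro a b hab h
    simpa using signRight_eq_signLeft hF hab fun x h1 h2 h0 => by simpa using h x h1 h2 h0
  | insert c T hc ih =>
    intro a b hab h
    have hcT : c ∉ T := fun h' => lt_irrefl _ (hc c h')
    rw [Finset.sum_insert hcT]
    by_cases hcab : a < c ∧ c < b
    · have h1 := ih a c hcab.1 fun x hax hxc h0 =>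
        (Finset.mem_insert.1 (h x hax (hxc.trans hcab.2) h0)).resolve_left hxc.ne
      have h2 := signRight_eq_signLeft hF hcab.2 fun x hcx hxb h0 => by
        rcases Finset.mem_insert.1 (h x (hcab.1.trans hcx) hxb h0) with rfl | hx
        · exact lt_irrefl _ hcx
        · exact lt_asymm hcx (hc x hx)
      have h3 : (∑ x ∈ T, if a < x ∧ x < b then signRight F x - signLeft F x else 0) =
          ∑ x ∈ T, if a < x ∧ x < c then signRight F x - signLeft F x else 0 := by
        refine Finset.sum_congr rfl fun x hx => ?_
        simp [hc x hx, (hc x hx).trans hcab.2]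
      rw [if_pos hcab, h3]
      linarith
    · rw [if_neg hcab, zero_add]
      refine ih a b hab fun x hax hxb h0 => ?_
      rcases Finset.mem_insert.1 (h x hax hxb h0) with rfl | hx
      · exact absurd ⟨hax, hxb⟩ hcab
      · exact hx

section Coprime

variable {R S : ℝ[X]}

theorem IsCoprime.eval_ne_zero_of_eval_eq_zero (h : IsCoprime R S) {x : ℝ} (hx : S.eval x = 0) :
    R.eval x ≠ 0 := by
  obtain ⟨u, v, huv⟩ := h
  intro h0
  simpa [hx, h0] using congrArg (eval x) huv

theorem indPlus_of_eval_ne_zero (R : ℝ[X]) {x : ℝ} (hx : S.eval x ≠ 0) : indPlus R S x = 0 := by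
  simp [indPlus, rootMultiplicity_eq_zero (p := S) hx]

theorem indMinus_of_eval_ne_zero (R : ℝ[X]) {x : ℝ} (hx : S.eval x ≠ 0) : indMinus R S x = 0 := by
  simp [indMinus, rootMultiplicity_eq_zero (p := S) hx]

theorem IsCoprime.indPlus_of_eval_eq_zero (h : IsCoprime R S) (hS : S ≠ 0) {x : ℝ}
    (hx : S.eval x = 0) :
    indPlus R S x = 1 / 2 * (Real.sign (R.eval x) * signRight S x) := by
  have hR := h.eval_ne_zero_of_eval_eq_zero hx
  have hm : 0 < rootMultiplicity x S := (rootMultiplicity_pos hS).2 hx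
  rw [indPlus, rootMultiplicity_eq_zero (p := R) hR, if_pos (by exact_mod_cast hm),
    unitEval_of_eval_ne_zero hR, Real.sign_mul_eq, signRight]

theorem IsCoprime.indMinus_of_eval_eq_zero (h : IsCoprime R S) (hS : S ≠ 0) {x : ℝ}
    (hx : S.eval x = 0) :
    indMinus R S x = 1 / 2 * (Real.sign (R.eval x) * signLeft S x) := by
  have hR := h.eval_ne_zero_of_eval_eq_zero hx
  have hm : 0 < rootMultiplicity x S := (rootMultiplicity_pos hS).2 hx
  rw [indMinus, rootMultiplicity_eq_zero (p := R) hR, if_pos (by exact_mod_cast hm),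
    unitEval_of_eval_ne_zero hR, Real.sign_mul_eq, signLeft, Nat.sub_zero]
  ring

theorem signRight_mul (hR : R ≠ 0) (hS : S ≠ 0) (x : ℝ) :
    signRight (R * S) x = signRight R x * signRight S x := by
  rw [signRight, unitEval_mul hR hS, Real.sign_mul_eq, signRight, signRight]

theorem signLeft_mul (hR : R ≠ 0) (hS : S ≠ 0) (x : ℝ) :
    signLeft (R * S) x = signLeft R x * signLeft S x := by
  rw [signLeft, unitEval_mul hR hS, rootMultiplicity_mul (mul_ne_zero hR hS), Real.sign_mul_eq,
    signLeft, signLeft, pow_add]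
  ring

theorem signRight_of_eval_ne_zero {x : ℝ} (hx : S.eval x ≠ 0) :
    signRight S x = Real.sign (S.eval x) := by
  rw [signRight, unitEval_of_eval_ne_zero hx]

theorem signLeft_of_eval_ne_zero {x : ℝ} (hx : S.eval x ≠ 0) :
    signLeft S x = Real.sign (S.eval x) := by
  rw [signLeft, unitEval_of_eval_ne_zero hx, rootMultiplicity_eq_zero (p := S) hx, pow_zero,
    one_mul]

theorem IsCoprime.indPlus_add_indPlus (h : IsCoprime R S) (hR : R ≠ 0) (hS : S ≠ 0) (x : ℝ) :
    indPlus R S x + indPlus S R x =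
      1 / 2 * (signRight (R * S) x - Real.sign ((R * S).eval x)) := by
  rw [signRight_mul hR hS, eval_mul]
  by_cases hSx : S.eval x = 0
  · have hRx := h.eval_ne_zero_of_eval_eq_zero hSx
    rw [h.indPlus_of_eval_eq_zero hS hSx, indPlus_of_eval_ne_zero S hRx,
      signRight_of_eval_ne_zero hRx, hSx, mul_zero, Real.sign_zero]
    ring
  · rw [indPlus_of_eval_ne_zero R hSx, signRight_of_eval_ne_zero hSx]
    by_cases hRx : R.eval x = 0
    · rw [h.symm.indPlus_of_eval_eq_zero hR hRx, hRx, zero_mul, Real.sign_zero]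
      ring
    · rw [indPlus_of_eval_ne_zero S hRx, signRight_of_eval_ne_zero hRx, Real.sign_mul_eq]
      ring

theorem IsCoprime.indMinus_add_indMinus (h : IsCoprime R S) (hR : R ≠ 0) (hS : S ≠ 0) (x : ℝ) :
    indMinus R S x + indMinus S R x =
      1 / 2 * (signLeft (R * S) x - Real.sign ((R * S).eval x)) := by
  rw [signLeft_mul hR hS, eval_mul]
  by_cases hSx : S.eval x = 0
  · have hRx := h.eval_ne_zero_of_eval_eq_zero hSx
    rw [h.indMinus_of_eval_eq_zero hS hSx, indMinus_of_eval_ne_zero S hRx,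
      signLeft_of_eval_ne_zero hRx, hSx, mul_zero, Real.sign_zero]
    ring
  · rw [indMinus_of_eval_ne_zero R hSx, signLeft_of_eval_ne_zero hSx]
    by_cases hRx : R.eval x = 0
    · rw [h.symm.indMinus_of_eval_eq_zero hR hRx, hRx, zero_mul, Real.sign_zero]
      ring
    · rw [indMinus_of_eval_ne_zero S hRx, signLeft_of_eval_ne_zero hRx, Real.sign_mul_eq]
      ring

theorem IsCoprime.abs_sign_sub_sign (h : IsCoprime R S) (x : ℝ) :
    |Real.sign (S.eval x) - Real.sign (R.eval x)| = 1 - Real.sign ((R * S).eval x) := by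
  rw [eval_mul, Real.sign_mul_eq]
  by_cases hSx : S.eval x = 0
  · have hRx := h.eval_ne_zero_of_eval_eq_zero hSx
    rcases Real.sign_apply_eq_of_ne_zero _ hRx with h1 | h1 <;> simp [hSx, h1]
  · rcases Real.sign_apply_eq_of_ne_zero _ hSx with h1 | h1 <;>
      rcases Real.sign_apply_eq (R.eval x) with h2 | h2 | h2 <;> rw [h1, h2] <;> norm_num

/-- The sum in the Cauchy index may be taken over any finite set containing the poles. -/
theorem cauchyIndex_eq_of_subset (hS : S ≠ 0) {T : Finset ℝ} (hT : S.roots.toFinset ⊆ T)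
    (a b : ℝ) :
    cauchyIndex R S a b = indPlus R S a +
      (∑ x ∈ T, if a < x ∧ x < b then indPlus R S x - indMinus R S x else 0) -
        indMinus R S b := by
  by_cases hR : R = 0
  · subst hR
    simp [cauchyIndex, indPlus, indMinus, unitEval]
  · rw [cauchyIndex, if_neg (by tauto)]
    congr 2
    refine Finset.sum_subset hT fun x _ hx => ?_
    have hx' : S.eval x ≠ 0 := fun h => hx (by simpa [hS] using h)
    simp [indPoint, indPlus_of_eval_ne_zero R hx', indMinus_of_eval_ne_zero R hx']

/-- The inversion formula for the Cauchy index. -/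
theorem IsCoprime.cauchyIndex_add_cauchyIndex (h : IsCoprime R S) (hR : R ≠ 0) (hS : S ≠ 0)
    {a b : ℝ} (hab : a < b) :
    cauchyIndex R S a b + cauchyIndex S R a b =
      1 / 2 * |Real.sign (S.eval a) - Real.sign (R.eval a)| -
        1 / 2 * |Real.sign (S.eval b) - Real.sign (R.eval b)| := by
  classical
  set T := R.roots.toFinset ∪ S.roots.toFinset
  have hjump := signRight_add_sum_jump (mul_ne_zero hR hS) T a b hab fun x _ _ h0 => by
    simpa [T, hR, hS, mul_eq_zero] using h0
  have hsum : (∑ x ∈ T, if a < x ∧ x < b then indPlus R S x - indMinus R S x else 0) +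
      (∑ x ∈ T, if a < x ∧ x < b then indPlus S R x - indMinus S R x else 0) =
      1 / 2 * ∑ x ∈ T, if a < x ∧ x < b then
        signRight (R * S) x - signLeft (R * S) x else 0 := by
    rw [← Finset.sum_add_distrib, Finset.mul_sum]
    refine Finset.sum_congr rfl fun x _ => ?_
    split_ifs
    · linarith [h.indPlus_add_indPlus hR hS x, h.indMinus_add_indMinus hR hS x]
    · simp
  rw [cauchyIndex_eq_of_subset hS (T := T) Finset.subset_union_right,
    cauchyIndex_eq_of_subset hR (T := T) Finset.subset_union_left,
    h.abs_sign_sub_sign, h.abs_sign_sub_sign]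
  linarith [h.indPlus_add_indPlus hR hS a, h.indMinus_add_indMinus hR hS b]

theorem IsCoprime.cauchyIndex_eq_neg {R' Q : ℝ[X]} (h : IsCoprime R S) (h' : IsCoprime R' S)
    (hS : S ≠ 0) (hQ : R + R' = Q * S) (a b : ℝ) :
    cauchyIndex R S a b = -cauchyIndex R' S a b := by
  have hsign {x : ℝ} (hx : S.eval x = 0) : Real.sign (R.eval x) = -Real.sign (R'.eval x) := by
    have := congrArg (eval x) hQ
    rw [eval_add, eval_mul, hx, mul_zero] at this
    rw [eq_neg_of_add_eq_zero_left this, Real.sign_neg]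
  have hplus (x : ℝ) : indPlus R S x = -indPlus R' S x := by
    by_cases hx : S.eval x = 0
    · rw [h.indPlus_of_eval_eq_zero hS hx, h'.indPlus_of_eval_eq_zero hS hx, hsign hx]
      ring
    · rw [indPlus_of_eval_ne_zero _ hx, indPlus_of_eval_ne_zero _ hx, neg_zero]
  have hminus (x : ℝ) : indMinus R S x = -indMinus R' S x := by
    by_cases hx : S.eval x = 0
    · rw [h.indMinus_of_eval_eq_zero hS hx, h'.indMinus_of_eval_eq_zero hS hx, hsign hx]
      ring
    · rw [indMinus_of_eval_ne_zero _ hx, indMinus_of_eval_ne_zero _ hx, neg_zero]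
  have hsum : (∑ x ∈ S.roots.toFinset, if a < x ∧ x < b then indPlus R S x - indMinus R S x
      else 0) = -∑ x ∈ S.roots.toFinset,
        if a < x ∧ x < b then indPlus R' S x - indMinus R' S x else 0 := by
    rw [← Finset.sum_neg_distrib]
    refine Finset.sum_congr rfl fun x _ => ?_
    rw [hplus, hminus]
    split_ifs <;> ring
  rw [cauchyIndex_eq_of_subset hS subset_rfl, cauchyIndex_eq_of_subset hS subset_rfl, hsum, hplus,
    hminus]
  ring

theorem indPlus_mul_left {D : ℝ[X]} (hD : D ≠ 0) (hR : R ≠ 0) (hS : S ≠ 0) (x : ℝ) :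
    indPlus (D * R) (D * S) x = indPlus R S x := by
  have hd := Real.sign_mul_self_eq_one (unitEval_ne_zero hD x)
  simp only [indPlus, rootMultiplicity_mul (mul_ne_zero hD hR),
    rootMultiplicity_mul (mul_ne_zero hD hS), unitEval_mul hD hR, unitEval_mul hD hS,
    Real.sign_mul_eq, Nat.cast_add, add_lt_add_iff_left]
  split_ifs
  · linear_combination (1 / 2 * Real.sign (unitEval R x) * Real.sign (unitEval S x)) * hd
  · rfl

theorem indMinus_mul_left {D : ℝ[X]} (hD : D ≠ 0) (hR : R ≠ 0) (hS : S ≠ 0) (x : ℝ) :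
    indMinus (D * R) (D * S) x = indMinus R S x := by
  have hd := Real.sign_mul_self_eq_one (unitEval_ne_zero hD x)
  simp only [indMinus, rootMultiplicity_mul (mul_ne_zero hD hR),
    rootMultiplicity_mul (mul_ne_zero hD hS), unitEval_mul hD hR, unitEval_mul hD hS,
    Real.sign_mul_eq, Nat.cast_add, add_lt_add_iff_left, Nat.add_sub_add_left]
  split_ifs
  · linear_combination (1 / 2 * (-1 : ℝ) ^ (rootMultiplicity x S - rootMultiplicity x R) *
      Real.sign (unitEval R x) * Real.sign (unitEval S x)) * hd
  · rfl

theorem cauchyIndex_mul_left {D : ℝ[X]} (hD : D ≠ 0) (hR : R ≠ 0) (hS : S ≠ 0) (a b : ℝ) :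
    cauchyIndex (D * R) (D * S) a b = cauchyIndex R S a b := by
  have hDS := mul_ne_zero hD hS
  have hsub : S.roots.toFinset ⊆ (D * S).roots.toFinset := by
    intro x
    simp only [Multiset.mem_toFinset, mem_roots hS, mem_roots hDS, IsRoot.def, eval_mul]
    intro hx
    rw [hx, mul_zero]
  rw [cauchyIndex_eq_of_subset hDS subset_rfl, cauchyIndex_eq_of_subset hS hsub]
  simp only [indPlus_mul_left hD hR hS, indMinus_mul_left hD hR hS]

end Coprime

theorem signVarAt_map_range_succ (s : ℕ → ℝ[X]) (n : ℕ) (x : ℝ) :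
    signVarAt ((List.range (n + 2)).map s) x =
      1 / 2 * |Real.sign ((s 0).eval x) - Real.sign ((s 1).eval x)| +
        signVarAt ((List.range (n + 1)).map fun k => s (k + 1)) x := by
  simp [signVarAt, List.range_succ_eq_map, signVar, Function.comp_def]

/-- Sturm's theorem for an abstract Sturm chain ending in `1`. -/
theorem isCoprime_and_cauchyIndex_eq_of_chain {a b : ℝ} (hab : a < b) (n : ℕ) :
    ∀ s : ℕ → ℝ[X], (∀ k ≤ n, s k ≠ 0) → s n = 1 → s (n + 1) = 0 →
      (∀ k < n, ∃ Q, s k + s (k + 2) = Q * s (k + 1)) →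
      IsCoprime (s 1) (s 0) ∧ cauchyIndex (s 1) (s 0) a b =
        signVarAt ((List.range (n + 1)).map s) a - signVarAt ((List.range (n + 1)).map s) b := by
  induction n with
  | zero =>
    intro s _ h1 h0 _
    rw [zero_add] at h0
    rw [h0, h1]
    exact ⟨isCoprime_one_right, by simp [cauchyIndex, signVarAt, signVar]⟩
  | succ n ih =>
    intro s hne h1 h0 hrec
    obtain ⟨hcop, hind⟩ := ih (fun k => s (k + 1)) (fun k hk => hne _ (by omega)) h1 h0
      fun k hk => hrec (k + 1) (by omega)
    simp only [zero_add, Nat.reduceAdd] at hcop hind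
    obtain ⟨Q, hQ⟩ := hrec 0 (by omega)
    simp only [zero_add] at hQ
    have hs0 := hne 0 (by omega)
    have hs1 := hne 1 (by omega)
    have hcop' : IsCoprime (s 0) (s 1) := by
      rw [show s 0 = -s 2 + Q * s 1 by rw [← hQ]; ring]
      exact IsCoprime.add_mul_right_left hcop.neg_left Q
    refine ⟨hcop'.symm, ?_⟩
    have hinv := hcop'.symm.cauchyIndex_add_cauchyIndex hs1 hs0 hab
    rw [hcop'.cauchyIndex_eq_neg hcop hs1 hQ] at hinv
    rw [signVarAt_map_range_succ, signVarAt_map_range_succ]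
    linarith

theorem euclidSeq_add (R S : ℝ[X]) (k : ℕ) :
    euclidSeq R S k + euclidSeq R S (k + 2) =
      euclidSeq R S k / euclidSeq R S (k + 1) * euclidSeq R S (k + 1) := by
  have h := EuclideanDomain.div_add_mod (euclidSeq R S k) (euclidSeq R S (k + 1))
  rw [euclidSeq]
  linear_combination -h

theorem euclidSeq_dvd {R S : ℝ[X]} {n : ℕ} (hzero : euclidSeq R S (n + 1) = 0) (j : ℕ) :
    ∀ k, k + j = n →
      euclidSeq R S n ∣ euclidSeq R S k ∧ euclidSeq R S n ∣ euclidSeq R S (k + 1) := by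
  induction j with
  | zero =>
    rintro k rfl
    simp [hzero]
  | succ j ih =>
    intro k hk
    obtain ⟨h1, h2⟩ := ih (k + 1) (by omega)
    refine ⟨?_, h1⟩
    rw [eq_sub_of_add_eq (euclidSeq_add R S k)]
    exact dvd_sub (h1.mul_left _) h2

/-- Sturm's theorem: let `(S_0, …, S_n)` be the euclidean Sturm chain associated to the
fraction `R/S` of nonzero polynomials, i.e. `S_k = P_k / P_n` where `(P_k)` is the
euclidean remainder sequence of `R/S` and `P_{n+1} = 0` is its first vanishing term
(so `P_n` is a gcd of `R` and `S` and `S_n = 1`).  Then for all `a < b`,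
`Ind_a^b(R/S) = V_a^b(S_0, S_1, …, S_n)`. -/
theorem sturm_theorem (R S : Polynomial ℝ) (hR : R ≠ 0) (hS : S ≠ 0) (n : ℕ)
    (hfirst : ∀ k ≤ n, euclidSeq R S k ≠ 0) (hzero : euclidSeq R S (n + 1) = 0) :
    ∀ a b : ℝ, a < b →
      cauchyIndex R S a b =
        signVarAt ((List.range (n + 1)).map fun k => euclidSeq R S k / euclidSeq R S n) a -
        signVarAt ((List.range (n + 1)).map fun k => euclidSeq R S k / euclidSeq R S n) b := by
  intro a b hab
  set D := euclidSeq R S n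
  set s : ℕ → ℝ[X] := fun k => euclidSeq R S k / D
  have hD : D ≠ 0 := hfirst n le_rfl
  have hs (k : ℕ) (hk : k ≤ n + 1) : D * s k = euclidSeq R S k := by
    refine EuclideanDomain.mul_div_cancel' hD ?_
    rcases hk.eq_or_lt with rfl | hk
    · rw [hzero]; exact dvd_zero D
    · exact (euclidSeq_dvd hzero (n - k) k (by omega)).1
  have hne (k : ℕ) (hk : k ≤ n) : s k ≠ 0 := by
    intro h
    exact hfirst k hk (by rw [← hs k (by omega), h, mul_zero])
  have hn : n ≠ 0 := by
    rintro rfl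
    exact hR hzero
  have hrec (k : ℕ) (hk : k < n) : ∃ Q, s k + s (k + 2) = Q * s (k + 1) := by
    refine ⟨euclidSeq R S k / euclidSeq R S (k + 1), mul_left_cancel₀ hD ?_⟩
    rw [mul_add, mul_left_comm, hs k (by omega), hs (k + 1) (by omega), hs (k + 2) (by omega)]
    exact euclidSeq_add R S k
  have key := (isCoprime_and_cauchyIndex_eq_of_chain hab n s hne (EuclideanDomain.div_self hD)
    (by simp [s, hzero]) hrec).2
  rw [← key, ← cauchyIndex_mul_left hD (hne 1 (by omega)) (hne 0 (by omega)), hs 1 (by omega),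
    hs 0 (by omega)]
  rfl
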